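/- arXiv:0911.0956 — 2 statements merged into one kernel-verified Lean document; each statement's English description precedes it below -/
import Mathlib

section
/- Let (Ω, F, (F_t)_{t≥0}, P) be a filtered probability space carrying a standard one-dimensional Brownian motion B. Let x ∈ ℝ, let A = {A_t : t ≥ 0} be a continuous nondecreasing adapted process with A_0 = 0, and let C = {C_t : t ≥ 0} be a continuous adapted process of bounded variation with C_0 = 0. Define X_t = x + B_{A_t} + C_t, and assume there is a constant κ > 0 such that |C_t| + A_t ≤ κt for all t ≥ 0 almost surely. Then for every T > 0 and every n > 3·max(|x|, κT), P( max_{0 ≤ t ≤ T} |X_t| ≥ n ) ≤ (12/n)·√(κT/(2π))·exp(−n²/(18κT)). -/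
/-!
STATEMENT 12 (Lemma 5.2 of the paper, in Dambis–Dubins–Schwarz form): on a filtered
probability space carrying a standard Brownian motion `B`, let
`X_t = x + B_{A_t} + C_t` with `A` continuous nondecreasing adapted, `A_0 = 0`,
`C` continuous adapted of bounded variation, `C_0 = 0`, and `|C_t| + A_t ≤ κt` for all
`t ≥ 0` a.s.  Then for every `T > 0` and every `n > 3·max(|x|, κT)`,
`P(max_{0≤t≤T}|X_t| ≥ n) ≤ (12/n)·√(κT/(2π))·exp(−n²/(18κT))`.
-/

open MeasureTheory ProbabilityTheory Real Set Filter

open scoped NNReal ENNReal Topology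

/-- **Lévy's maximal inequality**, one-sided: if every increment `S N - S k` is independent of the
past and nonnegative with probability at least `1 / 2`, then the running maximum has a tail at most
twice that of the endpoint. -/
theorem measure_exists_le_le_two_mul_of_indep {Ω : Type*} {m0 : MeasurableSpace Ω} (P : Measure Ω)
    (G : Filtration ℕ m0) {S : ℕ → Ω → ℝ} (hS : Adapted G S) {N : ℕ}
    (hindep : ∀ k ≤ N,
      Indep (MeasurableSpace.comap (fun ω => S N ω - S k ω) inferInstance) (G k) P)
    (hsymm : ∀ k ≤ N, 1 ≤ 2 * P {ω | 0 ≤ S N ω - S k ω}) (a : ℝ) :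
    P {ω | ∃ k ≤ N, a ≤ S k ω} ≤ 2 * P {ω | a ≤ S N ω} := by
  have hSm : ∀ k, Measurable (S k) := fun k => (hS k).mono (G.le k) le_rfl
  -- `E k` is the event that `k` is the first passage time above `a`
  set E : ℕ → Set Ω := fun k => {ω | a ≤ S k ω ∧ ∀ j < k, S j ω < a} with hE
  have hEG : ∀ k, MeasurableSet[G k] (E k) := by
    intro k
    have h : E k = {ω | a ≤ S k ω} ∩ ⋂ j : ℕ, ⋂ _ : j < k, {ω | S j ω < a} := by
      ext ω; simp [hE]
    rw [h]
    refine MeasurableSet.inter (hS k measurableSet_Ici) ?_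
    exact MeasurableSet.iInter fun j => MeasurableSet.iInter fun hj =>
      G.mono hj.le _ (hS j measurableSet_Iio)
  have hDm : ∀ k, MeasurableSet {ω | 0 ≤ S N ω - S k ω} := fun k =>
    measurableSet_le measurable_const ((hSm N).sub (hSm k))
  have hstep : ∀ k ≤ N, P (E k) ≤ 2 * P ({ω | 0 ≤ S N ω - S k ω} ∩ E k) := by
    intro k hk
    rw [(Indep_iff _ _ P).1 (hindep k hk) {ω | 0 ≤ S N ω - S k ω} _
      ⟨Ici 0, measurableSet_Ici, rfl⟩ (hEG k), ← mul_assoc]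
    exact le_mul_of_one_le_left' (hsymm k hk)
  have hdisj : (Finset.range (N + 1) : Set ℕ).PairwiseDisjoint
      fun k => {ω | 0 ≤ S N ω - S k ω} ∩ E k := by
    intro i _ j _ hij
    refine Set.disjoint_left.2 fun ω hi hj => ?_
    rcases hij.lt_or_gt with h | h
    · exact (hj.2.2 i h).not_ge hi.2.1
    · exact (hi.2.2 j h).not_ge hj.2.1
  calc P {ω | ∃ k ≤ N, a ≤ S k ω}
      ≤ P (⋃ k ∈ Finset.range (N + 1), E k) := by
        refine measure_mono fun ω ⟨k, hk, hak⟩ => ?_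
        classical
        have hex : ∃ k, a ≤ S k ω := ⟨k, hak⟩
        refine mem_biUnion (x := Nat.find hex) ?_
          ⟨Nat.find_spec hex, fun j hj => not_le.1 (Nat.find_min hex hj)⟩
        simpa [Nat.lt_succ_iff] using ⟨k, hk, hak⟩
    _ ≤ ∑ k ∈ Finset.range (N + 1), P (E k) := measure_biUnion_finset_le _ _
    _ ≤ ∑ k ∈ Finset.range (N + 1), 2 * P ({ω | 0 ≤ S N ω - S k ω} ∩ E k) :=
        Finset.sum_le_sum fun k hk => hstep k (Nat.lt_succ_iff.1 (Finset.mem_range.1 hk))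
    _ = 2 * P (⋃ k ∈ Finset.range (N + 1), {ω | 0 ≤ S N ω - S k ω} ∩ E k) := by
        rw [← Finset.mul_sum, measure_biUnion_finset hdisj]
        exact fun k _ => (hDm k).inter (G.le k _ (hEG k))
    _ ≤ 2 * P {ω | a ≤ S N ω} := by
        gcongr
        refine iUnion₂_subset fun k _ ω hω => ?_
        have h1 : 0 ≤ S N ω - S k ω := hω.1
        have h2 : a ≤ S k ω := hω.2.1
        change a ≤ S N ω
        linarith

/-- A centred Gaussian is nonnegative with probability at least `1 / 2`. -/
theorem one_le_two_mul_gaussianReal_Ici_zero (v : ℝ≥0) : 1 ≤ 2 * gaussianReal 0 v (Ici 0) := by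
  have hneg : gaussianReal 0 v (Iic 0) = gaussianReal 0 v (Ici 0) := by
    have h := gaussianReal_map_neg (μ := 0) (v := v)
    rw [neg_zero] at h
    conv_lhs => rw [← h, Measure.map_apply measurable_neg measurableSet_Iic]
    congr 1
    ext x
    simp
  calc (1 : ℝ≥0∞) = gaussianReal 0 v (Iic 0 ∪ Ici 0) := by rw [Iic_union_Ici, measure_univ]
    _ ≤ gaussianReal 0 v (Iic 0) + gaussianReal 0 v (Ici 0) := measure_union_le _ _
    _ = 2 * gaussianReal 0 v (Ici 0) := by rw [hneg, two_mul]

/-- The **Mills ratio** upper bound for a centred Gaussian tail. -/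
theorem gaussianReal_Ici_le {v : ℝ≥0} (hv : v ≠ 0) {a : ℝ} (ha : 0 < a) :
    gaussianReal 0 v (Ici a) ≤
      ENNReal.ofReal (√(v / (2 * π)) / a * rexp (-a ^ 2 / (2 * v))) := by
  have hv' : (0 : ℝ) < v := by positivity
  have hderiv : ∀ x ∈ Ici a, HasDerivAt (fun x => -(v / a * gaussianPDFReal 0 v x))
      (x / a * gaussianPDFReal 0 v x) x := by
    intro x _
    have h : HasDerivAt (fun x : ℝ => -(v / a * ((√(2 * π * v))⁻¹ * rexp (-(x - 0) ^ 2 / (2 * v)))))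
        _ x := ((((((hasDerivAt_id' x).sub_const 0).pow 2).neg.div_const (2 * (v : ℝ))).exp.const_mul
      (√(2 * π * v))⁻¹).const_mul (v / a : ℝ)).neg
    refine h.congr_deriv ?_
    rw [gaussianPDFReal]
    simp only [sub_zero, Pi.neg_apply, Pi.pow_apply, neg_div]
    field_simp
    norm_num
  have hnonneg : ∀ x ∈ Ioi a, 0 ≤ x / a * gaussianPDFReal 0 v x := fun x hx =>
    mul_nonneg (div_nonneg (ha.trans hx).le ha.le) (gaussianPDFReal_nonneg _ _ _)
  have hlim : Tendsto (fun x => -(v / a * gaussianPDFReal 0 v x)) atTop (𝓝 0) := by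
    have h : Tendsto (fun x : ℝ => -x ^ 2 / (2 * v)) atTop atBot := by
      simp_rw [neg_div]
      exact tendsto_neg_atTop_atBot.comp
        ((tendsto_pow_atTop two_ne_zero).atTop_div_const (by positivity))
    have h2 := (((tendsto_exp_atBot.comp h).const_mul (√(2 * π * v))⁻¹).const_mul (v / a : ℝ)).neg
    simpa [gaussianPDFReal, Function.comp_def] using h2
  have hint := integrableOn_Ioi_deriv_of_nonneg' hderiv hnonneg hlim
  have hval := integral_Ioi_of_hasDerivAt_of_nonneg' hderiv hnonneg hlim
  rw [gaussianReal_apply_eq_integral 0 hv, integral_Ici_eq_integral_Ioi]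
  refine ENNReal.ofReal_le_ofReal ?_
  calc ∫ x in Ioi a, gaussianPDFReal 0 v x
      ≤ ∫ x in Ioi a, x / a * gaussianPDFReal 0 v x := by
        refine setIntegral_mono_on (integrable_gaussianPDFReal 0 v).integrableOn hint
          measurableSet_Ioi fun x hx => ?_
        refine le_mul_of_one_le_left (gaussianPDFReal_nonneg _ _ _) ?_
        exact (one_le_div ha).2 (le_of_lt hx)
    _ = √(v / (2 * π)) / a * rexp (-a ^ 2 / (2 * v)) := by
        rw [hval, gaussianPDFReal, Real.sqrt_div hv'.le, Real.sqrt_mul (by positivity) (v : ℝ)]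
        have hs : √(v : ℝ) * √(v : ℝ) = v := Real.mul_self_sqrt hv'.le
        have hs0 : √(v : ℝ) ≠ 0 := (Real.sqrt_pos.2 hv').ne'
        simp only [sub_zero, zero_sub, neg_neg]
        field_simp
        linear_combination (-1 : ℝ) * hs

/-- If `P (Y k)` is bounded by `c` for all `k`, so is the probability of `⋃ₙ ⋂_{k ≥ n} Y k`. -/
theorem measure_eventually_le_of_forall_le {Ω : Type*} {m0 : MeasurableSpace Ω} {P : Measure Ω}
    {Y : ℕ → Set Ω} {c : ℝ≥0∞} (hY : ∀ k, P (Y k) ≤ c) :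
    P {ω | ∀ᶠ k in atTop, ω ∈ Y k} ≤ c := by
  have h : {ω | ∀ᶠ k in atTop, ω ∈ Y k} = ⋃ n, ⋂ k, ⋂ _ : n ≤ k, Y k := by
    ext ω; simp [eventually_atTop]
  rw [h, Monotone.measure_iUnion]
  · exact iSup_le fun n => (measure_mono (iInter₂_subset n le_rfl)).trans (hY n)
  · exact fun i j hij => iInter_mono fun k => iInter_mono' fun hk => ⟨hij.trans hk, le_rfl⟩

/-- Tail bound for the maximum over `[0, s]` of a continuous process with independent centred
Gaussian increments. -/
theorem measure_exists_Icc_lt_le {Ω : Type*} {m0 : MeasurableSpace Ω} (P : Measure Ω)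
    (F : Filtration ℝ m0) {B : ℝ → Ω → ℝ} (hBadapted : Adapted F B)
    (hB0 : ∀ᵐ ω ∂P, B 0 ω = 0) (hBcont : ∀ᵐ ω ∂P, Continuous fun t => B t ω)
    (hBlaw : ∀ s t : ℝ, 0 ≤ s → s ≤ t →
      Measure.map (fun ω => B t ω - B s ω) P = gaussianReal 0 (Real.toNNReal (t - s)))
    (hBindep : ∀ s t : ℝ, 0 ≤ s → s ≤ t →
      Indep (MeasurableSpace.comap (fun ω => B t ω - B s ω) inferInstance) (F s) P)
    {s : ℝ} (hs : 0 < s) {a : ℝ} (ha : 0 < a) :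
    P {ω | ∃ t ∈ Icc 0 s, a < B t ω} ≤
      ENNReal.ofReal (2 * (√(s / (2 * π)) / a * rexp (-a ^ 2 / (2 * s)))) := by
  have hBm : ∀ t, Measurable (B t) := fun t => (hBadapted t).mono (F.le t) le_rfl
  have hend : P {ω | a ≤ B s ω} = gaussianReal 0 (Real.toNNReal s) (Ici a) := by
    have h := hBlaw 0 s le_rfl hs.le
    rw [sub_zero] at h
    rw [← h, Measure.map_apply ((hBm s).fun_sub (hBm 0)) measurableSet_Ici]
    refine measure_congr ?_
    filter_upwards [hB0] with ω hω
    refine propext ?_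
    change a ≤ B s ω ↔ a ≤ B s ω - B 0 ω
    rw [hω, sub_zero]
  have hgrid : ∀ N : ℕ, P {ω | ∃ k ≤ N + 1, a ≤ B (s * (k / (N + 1 : ℕ))) ω} ≤
      2 * P {ω | a ≤ B s ω} := by
    intro N
    set t : ℕ → ℝ := fun k => s * (k / (N + 1 : ℕ)) with ht
    have htmono : Monotone t := fun i j hij => by simp only [ht]; gcongr
    have ht0 : ∀ k, 0 ≤ t k := fun k => by positivity
    have htN : t (N + 1) = s := by simp only [ht]; rw [div_self (by positivity), mul_one]
    let G : Filtration ℕ m0 :=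
      { seq := fun k => F (t k)
        mono' := fun i j hij => F.mono (htmono hij)
        le' := fun k => F.le (t k) }
    have := measure_exists_le_le_two_mul_of_indep P G (S := fun k => B (t k)) (N := N + 1)
      (fun k => hBadapted (t k)) (fun k hk => hBindep _ _ (ht0 k) (htmono hk)) (fun k hk => ?_) a
    · simpa only [htN] using this
    · have h := one_le_two_mul_gaussianReal_Ici_zero (Real.toNNReal (t (N + 1) - t k))
      rwa [← hBlaw _ _ (ht0 k) (htmono hk),
        Measure.map_apply ((hBm _).fun_sub (hBm _)) measurableSet_Ici] at h
  calc P {ω | ∃ t ∈ Icc 0 s, a < B t ω}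
      ≤ P {ω | ∀ᶠ N : ℕ in atTop, ω ∈ {ω | ∃ k ≤ N + 1, a ≤ B (s * (k / (N + 1 : ℕ))) ω}} := by
        refine measure_mono_ae ?_
        filter_upwards [hBcont] with ω hω
        rintro ⟨t, ⟨ht0, hts⟩, hat⟩
        have hr : 0 ≤ t / s := by positivity
        have hlim : Tendsto (fun N : ℕ => s * ((⌊t / s * (N + 1 : ℕ)⌋₊ : ℝ) / (N + 1 : ℕ))) atTop
            (𝓝 t) := by
          have h := ((tendsto_nat_floor_mul_div_atTop hr).comp
            (tendsto_natCast_atTop_atTop.comp (tendsto_add_atTop_nat 1))).const_mul s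
          rwa [mul_div_cancel₀ _ hs.ne'] at h
        filter_upwards [((hω.tendsto t).comp hlim).eventually (lt_mem_nhds hat)] with N hN
        refine ⟨_, Nat.floor_le_of_le ?_, le_of_lt hN⟩
        exact mul_le_of_le_one_left (by positivity) ((div_le_one hs).2 hts)
    _ ≤ 2 * P {ω | a ≤ B s ω} := measure_eventually_le_of_forall_le hgrid
    _ ≤ _ := by
        have h := gaussianReal_Ici_le (v := Real.toNNReal s) (by simpa using hs) ha
        rw [Real.coe_toNNReal s hs.le] at h
        rw [hend, ENNReal.ofReal_mul zero_le_two, ENNReal.ofReal_ofNat]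
        gcongr

theorem semimartingale_maximal_tail_bound
    {Ω : Type*} {m0 : MeasurableSpace Ω} (P : Measure Ω) [IsProbabilityMeasure P]
    (F : Filtration ℝ m0)
    -- `B` is a standard one-dimensional Brownian motion for the filtration `F`
    (B : ℝ → Ω → ℝ)
    (hBmeas : ∀ t, Measurable (B t))
    (hBadapted : Adapted F B)
    (hB0 : ∀ᵐ ω ∂P, B 0 ω = 0)
    (hBcont : ∀ᵐ ω ∂P, Continuous fun t => B t ω)
    (hBlaw : ∀ s t : ℝ, 0 ≤ s → s ≤ t →
      Measure.map (fun ω => B t ω - B s ω) P = gaussianReal 0 (Real.toNNReal (t - s)))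
    (hBindep : ∀ s t : ℝ, 0 ≤ s → s ≤ t →
      Indep (MeasurableSpace.comap (fun ω => B t ω - B s ω) inferInstance) (F s) P)
    -- the time change `A` and the bounded-variation part `C`
    (x : ℝ) (A C : ℝ → Ω → ℝ)
    (hAadapted : Adapted F A) (hCadapted : Adapted F C)
    (hA0 : ∀ ω, A 0 ω = 0) (hC0 : ∀ ω, C 0 ω = 0)
    (hAcont : ∀ ω, Continuous fun t => A t ω)
    (hCcont : ∀ ω, Continuous fun t => C t ω)
    (hAmono : ∀ ω, MonotoneOn (fun t => A t ω) (Ici 0))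
    (hCbv : ∀ ω, LocallyBoundedVariationOn (fun t => C t ω) (Ici 0))
    (κ : ℝ) (hκ : 0 < κ)
    (hbound : ∀ᵐ ω ∂P, ∀ t ≥ (0 : ℝ), |C t ω| + A t ω ≤ κ * t)
    -- the semimartingale `X`
    (X : ℝ → Ω → ℝ) (hX : ∀ t ω, X t ω = x + B (A t ω) ω + C t ω)
    (T : ℝ) (hT : 0 < T) (n : ℝ) (hn : 3 * max |x| (κ * T) < n) :
    P {ω | ∃ t ∈ Icc (0 : ℝ) T, n ≤ |X t ω|} ≤
      ENNReal.ofReal ((12 / n) * Real.sqrt (κ * T / (2 * π)) *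
        Real.exp (-n ^ 2 / (18 * κ * T))) := by
  have hs : 0 < κ * T := mul_pos hκ hT
  have hxn : |x| < n / 3 := by linarith [le_max_left |x| (κ * T)]
  have hTn : κ * T < n / 3 := by linarith [le_max_right |x| (κ * T)]
  have hn0 : 0 < n / 3 := hs.trans hTn
  have hpos := measure_exists_Icc_lt_le P F hBadapted hB0 hBcont hBlaw hBindep hs hn0
  have hneg := measure_exists_Icc_lt_le P F (B := fun t ω => -B t ω)
    (fun t => (hBadapted t).neg) (hB0.mono fun ω h => by simp [h])
    (hBcont.mono fun ω h => h.neg)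
    (fun s t h0 hst => by
      have h := gaussianReal_map_neg (μ := 0) (v := Real.toNNReal (t - s))
      rw [neg_zero] at h
      rw [← h, ← hBlaw s t h0 hst,
        Measure.map_map measurable_neg ((hBmeas t).fun_sub (hBmeas s))]
      congr 1
      ext ω
      simp only [Function.comp_apply]
      ring)
    (fun s t h0 hst => by
      refine indep_of_indep_of_le_left (hBindep s t h0 hst) (Measurable.comap_le ?_)
      have h := (comap_measurable fun ω => B t ω - B s ω).neg
      refine (congrArg _ ?_).mp h
      ext ω
      simp only [Pi.neg_apply]
      ring)
    hs hn0
  have hsub : P {ω | ∃ t ∈ Icc (0 : ℝ) T, n ≤ |X t ω|} ≤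
      P ({ω | ∃ t ∈ Icc 0 (κ * T), n / 3 < B t ω} ∪ {ω | ∃ t ∈ Icc 0 (κ * T), n / 3 < -B t ω}) := by
    refine measure_mono_ae ?_
    filter_upwards [hbound] with ω hω
    rintro ⟨t, ⟨ht0, htT⟩, hnt⟩
    have hb := hω t ht0
    have hκt : κ * t ≤ κ * T := by gcongr
    have hA : 0 ≤ A t ω := (hA0 ω).symm.le.trans (hAmono ω self_mem_Ici ht0 ht0)
    have hAT : A t ω ≤ κ * T := by linarith [abs_nonneg (C t ω)]
    have hB : n / 3 < |B (A t ω) ω| := by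
      have h := abs_add_three x (B (A t ω) ω) (C t ω)
      rw [← hX] at h
      linarith
    rcases lt_abs.1 hB with h | h
    · exact Or.inl ⟨_, ⟨hA, hAT⟩, h⟩
    · exact Or.inr ⟨_, ⟨hA, hAT⟩, h⟩
  refine hsub.trans ((measure_union_le _ _).trans ((add_le_add hpos hneg).trans_eq ?_))
  rw [← ENNReal.ofReal_add (by positivity) (by positivity)]
  have he : -(n / 3) ^ 2 / (2 * (κ * T)) = -n ^ 2 / (18 * κ * T) := by
    field_simp
    ring
  rw [he]
  congr 1
  field_simp
  norm_num
end

section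
/- Let (Z,d) be a nonempty metric space and let Ψ : Z×Z → ℝ be bounded above. For ε > 0 set m(ε) = sup_{(z,w) ∈ Z×Z} [Ψ(z,w) − d(z,w)²/(2ε)], and set m₀ = lim_{η→0⁺} sup{Ψ(z,w) : d(z,w) < η} (the limit of a nonincreasing function of η). Then: (i) m(ε) is nondecreasing in ε and lim_{ε→0⁺} m(ε) = m₀; (ii) if for some ε > 0 the supremum defining m(ε) is attained at (z_ε, w_ε) ∈ Z×Z, then m(ε) ≤ m(2ε) − d(z_ε,w_ε)²/(4ε); (iii) consequently, if the suprema defining m(ε) are attained at points (z_ε,w_ε) for all sufficiently small ε > 0 and m₀ is finite, then d(z_ε,w_ε)²/ε → 0 as ε → 0⁺. -/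
/-!
STATEMENT 13: abstract doubling-of-variables estimates.  For Ψ : Z×Z → ℝ bounded above
on a nonempty metric space Z, let m(ε) = sup [Ψ(z,w) − d(z,w)²/(2ε)] and
m₀ = lim_{η→0⁺} sup {Ψ(z,w) : d(z,w) < η}.  Then (i) m is nondecreasing and
m(ε) → m₀ as ε → 0⁺; (ii) if the supremum defining m(ε) is attained at (z_ε,w_ε) then
m(ε) ≤ m(2ε) − d(z_ε,w_ε)²/(4ε); (iii) if the suprema are attained for all small ε and
m₀ is finite, then d(z_ε,w_ε)²/ε → 0 as ε → 0⁺.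
-/

open Set Filter Topology

noncomputable section

/-- `m(ε) = sup_{(z,w)} [Ψ(z,w) − d(z,w)²/(2ε)]`. -/
def mEps {Z : Type*} [MetricSpace Z] (Ψ : Z × Z → ℝ) (ε : ℝ) : ℝ :=
  sSup {r | ∃ z w : Z, r = Ψ (z, w) - dist z w ^ 2 / (2 * ε)}

/-- `s(η) = sup {Ψ(z,w) : d(z,w) < η}`. -/
def sEta {Z : Type*} [MetricSpace Z] (Ψ : Z × Z → ℝ) (η : ℝ) : ℝ :=
  sSup {r | ∃ z w : Z, dist z w < η ∧ r = Ψ (z, w)}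

/-- `m₀ = lim_{η→0⁺} s(η)`, the limit of a nonincreasing function of `η`, i.e. the
infimum of `s(η)` over `η > 0`. -/
def mZero {Z : Type*} [MetricSpace Z] (Ψ : Z × Z → ℝ) : ℝ :=
  sInf {r | ∃ η : ℝ, 0 < η ∧ r = sEta Ψ η}

section

variable {Z : Type*} [MetricSpace Z] {Ψ : Z × Z → ℝ}

theorem le_mEps (hbdd : BddAbove (range Ψ)) {ε : ℝ} (hε : 0 < ε) (z w : Z) :
    Ψ (z, w) - dist z w ^ 2 / (2 * ε) ≤ mEps Ψ ε := by
  obtain ⟨C, hC⟩ := hbdd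
  refine le_csSup ⟨C, ?_⟩ ⟨z, w, rfl⟩
  rintro _ ⟨x, y, rfl⟩
  exact (sub_le_self _ (by positivity)).trans (hC (mem_range_self _))

theorem mEps_le [Nonempty Z] {ε a : ℝ}
    (h : ∀ z w : Z, Ψ (z, w) - dist z w ^ 2 / (2 * ε) ≤ a) : mEps Ψ ε ≤ a := by
  obtain ⟨z⟩ := ‹Nonempty Z›
  refine csSup_le ⟨_, z, z, rfl⟩ ?_
  rintro _ ⟨x, y, rfl⟩
  exact h x y

theorem le_sEta (hbdd : BddAbove (range Ψ)) {η : ℝ} {z w : Z} (h : dist z w < η) :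
    Ψ (z, w) ≤ sEta Ψ η := by
  refine le_csSup (hbdd.mono ?_) ⟨z, w, h, rfl⟩
  rintro _ ⟨x, y, -, rfl⟩
  exact mem_range_self _

theorem sEta_le [Nonempty Z] {η a : ℝ} (hη : 0 < η)
    (h : ∀ z w : Z, dist z w < η → Ψ (z, w) ≤ a) : sEta Ψ η ≤ a := by
  obtain ⟨z⟩ := ‹Nonempty Z›
  refine csSup_le ⟨_, z, z, by simpa using hη, rfl⟩ ?_
  rintro _ ⟨x, y, hxy, rfl⟩
  exact h x y hxy

theorem mZero_le_sEta [Nonempty Z] (hbdd : BddAbove (range Ψ)) {η : ℝ} (hη : 0 < η) :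
    mZero Ψ ≤ sEta Ψ η := by
  obtain ⟨z⟩ := ‹Nonempty Z›
  refine csInf_le ⟨Ψ (z, z), ?_⟩ ⟨η, hη, rfl⟩
  rintro _ ⟨θ, hθ, rfl⟩
  exact le_sEta hbdd (by simpa using hθ)

theorem mEps_mono [Nonempty Z] (hbdd : BddAbove (range Ψ)) {ε ε' : ℝ} (hε : 0 < ε)
    (h : ε ≤ ε') : mEps Ψ ε ≤ mEps Ψ ε' := by
  refine mEps_le fun z w => le_trans ?_ (le_mEps hbdd (hε.trans_le h) z w)
  gcongr

theorem mZero_le_mEps [Nonempty Z] (hbdd : BddAbove (range Ψ)) {ε : ℝ} (hε : 0 < ε) :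
    mZero Ψ ≤ mEps Ψ ε := by
  refine le_of_forall_pos_le_add fun δ hδ => ?_
  have hη : 0 < √(2 * ε * δ) := by positivity
  refine (mZero_le_sEta hbdd hη).trans (sEta_le hη fun z w hzw => ?_)
  have hsq : dist z w ^ 2 ≤ δ * (2 * ε) := by
    rw [mul_comm]
    exact ((Real.lt_sqrt dist_nonneg).1 hzw).le
  have hpen : dist z w ^ 2 / (2 * ε) ≤ δ := (div_le_iff₀ (by positivity)).2 hsq
  linarith [le_mEps hbdd hε z w]

theorem eventually_mEps_le_sEta [Nonempty Z] (hbdd : BddAbove (range Ψ)) {η : ℝ}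
    (hη : 0 < η) : ∀ᶠ ε in 𝓝[>] 0, mEps Ψ ε ≤ sEta Ψ η := by
  obtain ⟨C, hC⟩ := hbdd
  have hlim : Tendsto (fun ε : ℝ => η ^ 2 / 2 * ε⁻¹) (𝓝[>] 0) atTop :=
    tendsto_inv_nhdsGT_zero.const_mul_atTop (by positivity)
  filter_upwards [hlim.eventually_ge_atTop (C - sEta Ψ η), self_mem_nhdsWithin]
    with ε hpen (hε : 0 < ε)
  refine mEps_le fun z w => ?_
  rcases lt_or_ge (dist z w) η with h | h
  · exact (sub_le_self _ (by positivity)).trans (le_sEta ⟨C, hC⟩ h)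
  · have hdist : η ^ 2 / (2 * ε) ≤ dist z w ^ 2 / (2 * ε) := by gcongr
    have heq : η ^ 2 / 2 * ε⁻¹ = η ^ 2 / (2 * ε) := by field_simp
    linarith [hC (mem_range_self (z, w))]

theorem tendsto_mEps [Nonempty Z] (hbdd : BddAbove (range Ψ)) :
    Tendsto (fun ε => mEps Ψ ε) (𝓝[>] 0) (𝓝 (mZero Ψ)) := by
  refine tendsto_order.2 ⟨fun a ha => ?_, fun a ha => ?_⟩
  · filter_upwards [self_mem_nhdsWithin] with ε hε
    exact ha.trans_le (mZero_le_mEps hbdd hε)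
  · obtain ⟨_, ⟨η, hη, rfl⟩, hlt⟩ :=
      exists_lt_of_csInf_lt (s := {r | ∃ η : ℝ, 0 < η ∧ r = sEta Ψ η})
        ⟨_, 1, one_pos, rfl⟩ ha
    filter_upwards [eventually_mEps_le_sEta hbdd hη] with ε hε
    exact hε.trans_lt hlt

theorem mEps_le_mEps_two_mul_sub [Nonempty Z] (hbdd : BddAbove (range Ψ)) {ε : ℝ}
    (hε : 0 < ε) {z₀ w₀ : Z}
    (hmax : ∀ z w : Z, Ψ (z, w) - dist z w ^ 2 / (2 * ε) ≤
      Ψ (z₀, w₀) - dist z₀ w₀ ^ 2 / (2 * ε)) :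
    mEps Ψ ε ≤ mEps Ψ (2 * ε) - dist z₀ w₀ ^ 2 / (4 * ε) := by
  have h := le_mEps hbdd (by positivity : 0 < 2 * ε) z₀ w₀
  have h₁ : dist z₀ w₀ ^ 2 / (2 * ε) = 2 * (dist z₀ w₀ ^ 2 / (4 * ε)) := by
    field_simp
    norm_num
  have h₂ : dist z₀ w₀ ^ 2 / (2 * (2 * ε)) = dist z₀ w₀ ^ 2 / (4 * ε) := by
    ring_nf
  linarith [mEps_le hmax]

theorem tendsto_dist_sq_div [Nonempty Z] (hbdd : BddAbove (range Ψ)) {zf wf : ℝ → Z}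
    (hmax : ∀ᶠ ε in 𝓝[>] 0, ∀ z w : Z, Ψ (z, w) - dist z w ^ 2 / (2 * ε) ≤
      Ψ (zf ε, wf ε) - dist (zf ε) (wf ε) ^ 2 / (2 * ε)) :
    Tendsto (fun ε => dist (zf ε) (wf ε) ^ 2 / ε) (𝓝[>] 0) (𝓝 0) := by
  have hdouble : Tendsto (fun ε : ℝ => 2 * ε) (𝓝[>] 0) (𝓝[>] 0) := by
    refine tendsto_nhdsWithin_iff.2 ⟨?_, ?_⟩
    · exact ((continuous_const_mul (2 : ℝ)).tendsto' 0 0 (mul_zero 2)).mono_left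
        nhdsWithin_le_nhds
    · filter_upwards [self_mem_nhdsWithin] with ε (hε : 0 < ε)
      exact mul_pos two_pos hε
  have hlim : Tendsto (fun ε => 4 * (mEps Ψ (2 * ε) - mEps Ψ ε)) (𝓝[>] 0) (𝓝 0) := by
    simpa using (((tendsto_mEps hbdd).comp hdouble).sub (tendsto_mEps hbdd)).const_mul 4
  refine squeeze_zero' ?_ ?_ hlim
  · filter_upwards [self_mem_nhdsWithin] with ε (hε : 0 < ε)
    positivity
  · filter_upwards [hmax, self_mem_nhdsWithin] with ε hm (hε : 0 < ε)
    have heq : dist (zf ε) (wf ε) ^ 2 / ε = 4 * (dist (zf ε) (wf ε) ^ 2 / (4 * ε)) := by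
      field_simp
    linarith [mEps_le_mEps_two_mul_sub hbdd hε hm]

end

theorem doubling_of_variables {Z : Type*} [MetricSpace Z] [Nonempty Z]
    (Ψ : Z × Z → ℝ) (hbdd : BddAbove (Set.range Ψ)) :
    -- (i)
    ((∀ ε ε' : ℝ, 0 < ε → ε ≤ ε' → mEps Ψ ε ≤ mEps Ψ ε') ∧
      Tendsto (fun ε => mEps Ψ ε) (nhdsWithin 0 (Ioi 0)) (nhds (mZero Ψ))) ∧
    -- (ii)
    (∀ ε : ℝ, 0 < ε → ∀ zε wε : Z,
      (∀ z w : Z, Ψ (z, w) - dist z w ^ 2 / (2 * ε) ≤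
        Ψ (zε, wε) - dist zε wε ^ 2 / (2 * ε)) →
      mEps Ψ ε ≤ mEps Ψ (2 * ε) - dist zε wε ^ 2 / (4 * ε)) ∧
    -- (iii)
    (∀ zf wf : ℝ → Z,
      (∃ ε₀ > 0, ∀ ε ∈ Ioo (0 : ℝ) ε₀, ∀ z w : Z,
        Ψ (z, w) - dist z w ^ 2 / (2 * ε) ≤
          Ψ (zf ε, wf ε) - dist (zf ε) (wf ε) ^ 2 / (2 * ε)) →
      BddBelow {r | ∃ η : ℝ, 0 < η ∧ r = sEta Ψ η} →
      Tendsto (fun ε => dist (zf ε) (wf ε) ^ 2 / ε) (nhdsWithin 0 (Ioi 0)) (nhds 0)) := by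
  refine ⟨⟨fun ε ε' hε h => mEps_mono hbdd hε h, tendsto_mEps hbdd⟩,
    fun ε hε zε wε hmax => mEps_le_mEps_two_mul_sub hbdd hε hmax, ?_⟩
  rintro zf wf ⟨ε₀, hε₀, hmax⟩ -
  refine tendsto_dist_sq_div hbdd ?_
  filter_upwards [Ioo_mem_nhdsGT hε₀] with ε hε
  exact hmax ε hε
end
end
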